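/- (Nonlinear estimate, term A₄ in Lemma 3.1.) Under the Setting, there exists a constant C > 0 such that for every u ∈ C_c^∞(ℝⁿ, ℂ), ‖ |x|^{−τ} |u|^{p−1} (I_α * (|·|^{−τ}|u|^{p−1}|∇u|)) ‖_{L^{2n/(n+2)}(ℝⁿ)} ≤ C ‖∇u‖_{L^r(ℝⁿ)}^{2p−1}. -/

import Mathlib

open MeasureTheory Module Set
open scoped ENNReal NNReal

section
variable {E : Type*} [NormedAddCommGroup E] [NormedSpace ℝ E] [FiniteDimensional ℝ E]
  [MeasurableSpace E] [BorelSpace E] (μ : Measure E) [μ.IsAddHaarMeasure]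

theorem lintegral_comp_smul_addHaar (f : E → ℝ≥0∞) {R : ℝ} (hR : 0 < R) :
    ∫⁻ x, f (R • x) ∂μ = ENNReal.ofReal (R ^ (-(finrank ℝ E : ℝ))) * ∫⁻ x, f x ∂μ := by
  have h := Measure.map_addHaar_smul μ hR.ne'
  have h2 : ∫⁻ x, f x ∂(Measure.map (R • ·) μ) = ∫⁻ x, f (R • x) ∂μ :=
    lintegral_map_equiv f (Homeomorph.smul (Units.mk0 R hR.ne')).toMeasurableEquiv
  rw [← h2, h, lintegral_smul_measure, smul_eq_mul, Real.rpow_neg hR.le, Real.rpow_natCast,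
    abs_of_nonneg (by positivity)]

theorem lintegral_eq_mul_lintegral_comp_smul (f : E → ℝ≥0∞) {R : ℝ} (hR : 0 < R) :
    ∫⁻ x, f x ∂μ = ENNReal.ofReal (R ^ (finrank ℝ E : ℝ)) * ∫⁻ x, f (R • x) ∂μ := by
  rw [lintegral_comp_smul_addHaar μ f hR, ← mul_assoc, ← ENNReal.ofReal_mul (by positivity),
    ← Real.rpow_add hR]
  simp

theorem exists_lintegral_ball_rpow_le [Nontrivial E] {α : ℝ} (hα : 0 < α) :
    ∃ A : ℝ, 0 < A ∧ ∀ ρ : ℝ, 0 < ρ →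
      ∫⁻ z, (if ‖z‖ < ρ then ENNReal.ofReal (‖z‖ ^ (α - finrank ℝ E)) else 0) ∂μ
        ≤ ENNReal.ofReal (A * ρ ^ α) := by
  set d := finrank ℝ E
  have hd : 1 ≤ d := Module.finrank_pos
  have hint : IntegrableOn (fun x : E => ‖x‖ ^ (α - d)) (Metric.ball 0 1) μ := by
    rw [integrableOn_fun_norm_addHaar μ (f := fun y => y ^ (α - d))]
    have : IntegrableOn (fun y : ℝ => y ^ (α - 1)) (Ioo 0 1) := by
      rw [intervalIntegral.integrableOn_Ioo_rpow_iff one_pos]; linarith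
    refine this.congr_fun (fun y hy => ?_) measurableSet_Ioo
    simp only [smul_eq_mul]
    rw [← Real.rpow_natCast, ← Real.rpow_add hy.1]
    have hd' : ((finrank ℝ E - 1 : ℕ) : ℝ) = d - 1 := by simp [Nat.cast_sub hd, d]
    rw [hd']
    congr 1
    ring
  set A₀ := ∫⁻ z, (if ‖z‖ < 1 then ENNReal.ofReal (‖z‖ ^ (α - d)) else 0) ∂μ with hA₀
  have hfin : A₀ ≠ ⊤ := by
    have h := hint.lintegral_lt_top
    rw [← lintegral_indicator measurableSet_ball] at h
    refine ne_of_lt (lt_of_le_of_lt (le_of_eq ?_) h)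
    refine lintegral_congr fun z => ?_
    by_cases hz : ‖z‖ < 1
    · rw [if_pos hz, indicator_of_mem (by simpa using hz)]
    · rw [if_neg hz, indicator_of_notMem (by simpa using hz)]
  refine ⟨A₀.toReal + 1, by positivity, fun ρ hρ => ?_⟩
  rw [lintegral_eq_mul_lintegral_comp_smul μ _ hρ]
  have : ∀ x : E, (if ‖ρ • x‖ < ρ then ENNReal.ofReal (‖ρ • x‖ ^ (α - d)) else 0)
      = ENNReal.ofReal (ρ ^ (α - d)) * (if ‖x‖ < 1 then ENNReal.ofReal (‖x‖ ^ (α - d)) else 0) := by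
    intro x
    have h1 : ‖ρ • x‖ = ρ * ‖x‖ := by rw [norm_smul, Real.norm_of_nonneg hρ.le]
    have h2 : ρ * ‖x‖ < ρ ↔ ‖x‖ < 1 := by
      constructor <;> intro h <;> nlinarith
    rw [h1, Real.mul_rpow hρ.le (norm_nonneg _), ENNReal.ofReal_mul (by positivity)]
    simp only [h2, mul_ite, mul_zero]
  simp_rw [this]
  rw [lintegral_const_mul' _ _ ENNReal.ofReal_ne_top, ← hA₀, ← mul_assoc,
    ← ENNReal.ofReal_mul (by positivity), ← Real.rpow_add hρ, add_sub_cancel, mul_comm,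
    ENNReal.ofReal_mul (by positivity)]
  gcongr
  rw [ENNReal.le_ofReal_iff_toReal_le hfin (by positivity)]
  linarith

theorem exists_lintegral_compl_ball_rpow_le {q : ℝ} (hq : (finrank ℝ E : ℝ) < q) :
    ∃ B : ℝ, 0 < B ∧ ∀ ρ : ℝ, 0 < ρ →
      ∫⁻ z, (if ‖z‖ < ρ then 0 else ENNReal.ofReal (‖z‖ ^ (-q))) ∂μ
        ≤ ENNReal.ofReal (B * ρ ^ (finrank ℝ E - q)) := by
  set d := finrank ℝ E
  have hq0 : 0 < q := lt_of_le_of_lt (by positivity) hq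
  set A₀ := ∫⁻ z, (if ‖z‖ < 1 then 0 else ENNReal.ofReal (‖z‖ ^ (-q))) ∂μ with hA₀
  have hfin : A₀ ≠ ⊤ := by
    have h := finite_integral_one_add_norm (μ := μ) hq
    have h' : ∫⁻ x : E, ENNReal.ofReal (2 ^ q) * ENNReal.ofReal ((1 + ‖x‖) ^ (-q)) ∂μ < ⊤ := by
      rw [lintegral_const_mul' _ _ ENNReal.ofReal_ne_top]
      exact ENNReal.mul_lt_top ENNReal.ofReal_lt_top h
    refine ne_of_lt (lt_of_le_of_lt (lintegral_mono fun z => ?_) h')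
    split_ifs with hz
    · exact zero_le
    · rw [← ENNReal.ofReal_mul (by positivity)]
      apply ENNReal.ofReal_le_ofReal
      push Not at hz
      rw [Real.rpow_neg (by positivity), Real.rpow_neg (by positivity), ← div_eq_mul_inv,
        ← Real.div_rpow (by positivity) (by positivity), ← Real.inv_rpow (by positivity)]
      refine Real.rpow_le_rpow (by positivity) ?_ hq0.le
      rw [inv_eq_one_div, div_le_div_iff₀ (by positivity) (by positivity)]
      linarith
  refine ⟨A₀.toReal + 1, by positivity, fun ρ hρ => ?_⟩
  rw [lintegral_eq_mul_lintegral_comp_smul μ _ hρ]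
  have : ∀ x : E, (if ‖ρ • x‖ < ρ then 0 else ENNReal.ofReal (‖ρ • x‖ ^ (-q)))
      = ENNReal.ofReal (ρ ^ (-q)) * (if ‖x‖ < 1 then 0 else ENNReal.ofReal (‖x‖ ^ (-q))) := by
    intro x
    have h1 : ‖ρ • x‖ = ρ * ‖x‖ := by rw [norm_smul, Real.norm_of_nonneg hρ.le]
    have h2 : ρ * ‖x‖ < ρ ↔ ‖x‖ < 1 := by
      constructor <;> intro h <;> nlinarith
    rw [h1, Real.mul_rpow hρ.le (norm_nonneg _), ENNReal.ofReal_mul (by positivity)]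
    simp only [h2, mul_ite, mul_zero]
  simp_rw [this]
  rw [lintegral_const_mul' _ _ ENNReal.ofReal_ne_top, ← hA₀, ← mul_assoc,
    ← ENNReal.ofReal_mul (by positivity), ← Real.rpow_add hρ, ← sub_eq_add_neg, mul_comm,
    ENNReal.ofReal_mul (by positivity)]
  gcongr
  rw [ENNReal.le_ofReal_iff_toReal_le hfin (by positivity)]
  linarith

theorem lintegral_Ioi_ite_lt_rpow {γ : ℝ} (hγ : 0 < γ) (w : ℝ≥0∞) :
    ∫⁻ t in Ioi (0 : ℝ), (if ENNReal.ofReal t < w then ENNReal.ofReal (t ^ (γ - 1)) else 0)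
      = w ^ γ / ENNReal.ofReal γ := by
  have fin : ∀ v : ℝ, 0 ≤ v →
      ∫⁻ t in Ioi (0 : ℝ), (if t < v then ENNReal.ofReal (t ^ (γ - 1)) else 0)
      = ENNReal.ofReal (v ^ γ) / ENNReal.ofReal γ := by
    intro v hv
    have h1 : ∀ t : ℝ, (if t < v then ENNReal.ofReal (t ^ (γ - 1)) else 0)
        = (Iio v).indicator (fun t => ENNReal.ofReal (t ^ (γ - 1))) t := fun t => by
      simp [indicator_apply]
    simp_rw [h1]
    rw [lintegral_indicator measurableSet_Iio, Measure.restrict_restrict measurableSet_Iio,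
      inter_comm, Ioi_inter_Iio, restrict_Ioo_eq_restrict_Ioc]
    have hi : IntervalIntegrable (fun t : ℝ => t ^ (γ - 1)) volume 0 v :=
      intervalIntegral.intervalIntegrable_rpow' (by linarith)
    rw [← ofReal_integral_eq_lintegral_ofReal hi.1, ← intervalIntegral.integral_of_le hv,
      integral_rpow (Or.inl (by linarith)), ← ENNReal.ofReal_div_of_pos hγ]
    · simp [Real.zero_rpow hγ.ne']
    · filter_upwards [ae_restrict_mem measurableSet_Ioc] with t ht
      exact Real.rpow_nonneg ht.1.le _
  induction w with
  | top =>
    rw [ENNReal.top_rpow_of_pos hγ, ENNReal.top_div_of_ne_top ENNReal.ofReal_ne_top]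
    refine ENNReal.eq_top_of_forall_nnreal_le fun M => ?_
    have := fin ((M * γ) ^ γ⁻¹) (by positivity)
    rw [← Real.rpow_mul (by positivity), inv_mul_cancel₀ hγ.ne', Real.rpow_one,
      ← ENNReal.ofReal_div_of_pos hγ, mul_div_cancel_right₀ _ hγ.ne', ENNReal.ofReal_coe_nnreal] at this
    rw [← this]
    refine lintegral_mono fun t => ?_
    simp only [ENNReal.ofReal_lt_top, if_true]
    split_ifs <;> simp
  | coe v =>
    have := fin v v.coe_nonneg
    rw [← ENNReal.ofReal_rpow_of_nonneg v.coe_nonneg hγ.le, ENNReal.ofReal_coe_nnreal] at this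
    rw [← this]
    refine setLIntegral_congr_fun measurableSet_Ioi fun t ht => ?_
    have : ENNReal.ofReal t < v ↔ t < v := by
      rw [← ENNReal.ofReal_coe_nnreal, ENNReal.ofReal_lt_ofReal_iff_of_nonneg (le_of_lt ht)]
    simp only [this]
end

section
variable {E : Type*} [NormedAddCommGroup E] [NormedSpace ℝ E] [FiniteDimensional ℝ E]
  [MeasurableSpace E] [BorelSpace E] (μ : Measure E) [μ.IsAddHaarMeasure]

/-- The Riesz kernel `‖z‖ ^ (α - d)`, up to normalisation, with values in `ℝ≥0∞`. -/
noncomputable def rieszKernel (α : ℝ) (z : E) : ℝ≥0∞ :=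
  ENNReal.ofReal (‖z‖ ^ (α - finrank ℝ E))

theorem measurable_rieszKernel (α : ℝ) : Measurable (rieszKernel α : E → ℝ≥0∞) := by
  unfold rieszKernel
  fun_prop

/-- Truncating both the kernel (at radius `ρ`) and the function (at height `s`), a large value of
the Riesz potential forces a large value of the potential of the doubly truncated data. -/
theorem ofReal_half_le_lintegral_truncated {k f : E → ℝ≥0∞} (hk : Measurable k)
    (hf : Measurable f) {b b' ρ t : ℝ} {s : ℝ≥0∞} (hb : b.HolderConjugate b')
    (ht : 0 < t) (hf1 : ∫⁻ y, f y ^ b ∂μ ≤ 1)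
    (hfar : (∫⁻ z, (if ‖z‖ < ρ then 0 else k z) ^ b' ∂μ) ^ (1 / b') ≤ ENNReal.ofReal (t / 4))
    (hnear : s * ∫⁻ z, (if ‖z‖ < ρ then k z else 0) ∂μ ≤ ENNReal.ofReal (t / 4)) (x : E)
    (hx : ENNReal.ofReal t < ∫⁻ y, k (x - y) * f y ∂μ) :
    ENNReal.ofReal (t / 2) ≤
      ∫⁻ y, (if ‖x - y‖ < ρ then k (x - y) else 0) * (if s < f y then f y else 0) ∂μ := by
  have hball : MeasurableSet {z : E | ‖z‖ < ρ} := measurableSet_lt measurable_norm measurable_const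
  have hN : Measurable fun z => if ‖z‖ < ρ then k z else 0 := hk.ite hball measurable_const
  have hF : Measurable fun z => if ‖z‖ < ρ then 0 else k z := Measurable.ite hball measurable_const hk
  have hlev : MeasurableSet {y : E | s < f y} := measurableSet_lt measurable_const hf
  have hlo : Measurable fun y => if s < f y then 0 else f y :=
    Measurable.ite hlev measurable_const hf
  have hsub : Measurable fun y : E => x - y := measurable_const.sub measurable_id
  have hN' := hN.comp hsub
  have hF' := hF.comp hsub
  simp only [Function.comp_def] at hN' hF'
  have e1 : ∫⁻ y, (if ‖x - y‖ < ρ then 0 else k (x - y)) * f y ∂μ ≤ ENNReal.ofReal (t / 4) := by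
    refine (ENNReal.lintegral_mul_le_Lp_mul_Lq μ hb.symm hF'.aemeasurable hf.aemeasurable).trans ?_
    rw [lintegral_sub_left_eq_self (fun z => (if ‖z‖ < ρ then 0 else k z) ^ b') x]
    refine (mul_le_mul' hfar (ENNReal.rpow_le_one hf1 ?_)).trans (mul_one _).le
    exact one_div_nonneg.2 hb.nonneg
  have e2 : ∫⁻ y, (if ‖x - y‖ < ρ then k (x - y) else 0) * (if s < f y then 0 else f y) ∂μ
      ≤ ENNReal.ofReal (t / 4) := by
    refine le_trans (lintegral_mono (g := fun y => s * (if ‖x - y‖ < ρ then k (x - y) else 0))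
      fun y => ?_) ?_
    · simp only
      rw [mul_comm]
      gcongr
      split_ifs with h
      · exact zero_le
      · exact not_lt.1 h
    · rw [lintegral_const_mul _ hN',
        lintegral_sub_left_eq_self (fun z => if ‖z‖ < ρ then k z else 0) x]
      exact hnear
  set I := ∫⁻ y, (if ‖x - y‖ < ρ then k (x - y) else 0) * (if s < f y then f y else 0) ∂μ
  have e3 : ∫⁻ y, k (x - y) * f y ∂μ ≤ ENNReal.ofReal (t / 4) + (ENNReal.ofReal (t / 4) + I) := by
    calc ∫⁻ y, k (x - y) * f y ∂μ
        = ∫⁻ y, ((if ‖x - y‖ < ρ then 0 else k (x - y)) * f y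
          + ((if ‖x - y‖ < ρ then k (x - y) else 0) * (if s < f y then 0 else f y)
            + (if ‖x - y‖ < ρ then k (x - y) else 0) * (if s < f y then f y else 0))) ∂μ := by
          refine lintegral_congr fun y => ?_
          split_ifs <;> simp
      _ ≤ _ := by
          have m1 : Measurable fun y => (if ‖x - y‖ < ρ then 0 else k (x - y)) * f y := hF'.mul hf
          have m2 : Measurable fun y => (if ‖x - y‖ < ρ then k (x - y) else 0) *
            (if s < f y then 0 else f y) := hN'.mul hlo
          rw [lintegral_add_left m1, lintegral_add_left m2]
          gcongr
  by_contra! hI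
  refine absurd hx (not_lt.2 (e3.trans ?_))
  calc _ ≤ ENNReal.ofReal (t / 4) + (ENNReal.ofReal (t / 4) + ENNReal.ofReal (t / 2)) := by gcongr
    _ = ENNReal.ofReal t := by
      rw [← ENNReal.ofReal_add (by positivity) (by positivity),
        ← ENNReal.ofReal_add (by positivity) (by positivity)]
      congr 1; ring

theorem exists_lintegral_rieszKernel_rpow_le_of_le_one [Nontrivial E] {α b c : ℝ} (hα : 0 < α)
    (hb : 1 < b) (hc : 0 < c) (hbc : 1 / c = 1 / b - α / finrank ℝ E) :
    ∃ C : ℝ≥0∞, C ≠ ⊤ ∧ ∀ f : E → ℝ≥0∞, Measurable f → ∫⁻ y, f y ^ b ∂μ ≤ 1 →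
      ∫⁻ x, (∫⁻ y, rieszKernel α (x - y) * f y ∂μ) ^ c ∂μ ≤ C := by
  set d : ℝ := ((finrank ℝ E : ℕ) : ℝ) with hd
  have hd0 : 0 < d := by simpa [hd] using (Module.finrank_pos : 0 < finrank ℝ E)
  have hb0 : 0 < b := by linarith
  set b' := b.conjExponent with hb'
  have hbb : b.HolderConjugate b' := Real.HolderConjugate.conjExponent hb
  have hb'0 : 0 < b' := hbb.symm.pos
  have hinv : 1 / b' = 1 - 1 / b := by
    have := hbb.inv_add_inv_eq_one; rw [one_div, one_div]; linarith
  have hαd : α < d := by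
    have h1 : 0 < 1 / c := by positivity
    have h2 : 1 / b < 1 := by rw [div_lt_one hb0]; exact hb
    have : α / d < 1 := by linarith
    rwa [div_lt_one hd0] at this
  have hdc : d / c = d / b - α := by
    have : d * (1 / c) = d * (1 / b - α / d) := by rw [hbc]
    field_simp at this ⊢
    linarith
  have hq : d < (d - α) * b' := by
    have h1 : 0 < d / c := by positivity
    have h2 : d * (1 / b') < d - α := by
      rw [hinv]; have : d * (1 / b) = d / b := by ring
      linarith
    rw [mul_one_div, div_lt_iff₀ hb'0] at h2
    exact h2
  obtain ⟨A, hA, hnear⟩ := exists_lintegral_ball_rpow_le μ hα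
  obtain ⟨B, hB, hfar⟩ := exists_lintegral_compl_ball_rpow_le μ hq
  set B' := B ^ (1 / b')
  have hB' : 0 < B' := by positivity
  set c₀ := (4 * B') ^ (c / d)
  have hc₀ : 0 < c₀ := by positivity
  set K := 1 / (4 * A * c₀ ^ α) with hK
  have hK0 : 0 < K := by positivity
  set e := 1 + c * α / d with he
  have he0 : 0 < e := by positivity
  have hcb : e = c / b := by
    have : c * (1 / c) = c * (1 / b - α / d) := by rw [hbc]
    rw [mul_one_div_cancel hc.ne'] at this
    rw [he, this]; ring
  have hce : 0 < c - e := by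
    rw [hcb, sub_pos, div_lt_iff₀ hb0]; nlinarith
  have hce' : e⁻¹ * (c - e) = b - 1 := by
    rw [hcb]; field_simp
  let ρ : ℝ → ℝ := fun t => c₀ * t ^ (-(c / d))
  have hρ : ∀ t, 0 < t → 0 < ρ t := fun t ht => by positivity
  have hρα : ∀ t, 0 < t → (ρ t) ^ α = c₀ ^ α * t ^ (1 - e) := fun t ht => by
    simp only [ρ]
    rw [Real.mul_rpow hc₀.le (by positivity), ← Real.rpow_mul ht.le]
    congr 2
    rw [he]; ring
  have hρd : ∀ t, 0 < t → B' * (ρ t) ^ (-(d / c)) = t / 4 := fun t ht => by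
    simp only [ρ]
    rw [Real.mul_rpow hc₀.le (by positivity), ← Real.rpow_mul ht.le, ← Real.rpow_mul (by positivity)]
    have h1 : c / d * -(d / c) = -1 := by field_simp
    have h2 : -(c / d) * -(d / c) = 1 := by field_simp
    rw [h1, h2, Real.rpow_neg_one, Real.rpow_one]
    field_simp
  have hfar' : ∀ t, 0 < t →
      (∫⁻ z : E, (if ‖z‖ < ρ t then 0 else rieszKernel α z) ^ b' ∂μ) ^ (1 / b')
        ≤ ENNReal.ofReal (t / 4) := fun t ht => by
    have h1 : ∀ z : E, (if ‖z‖ < ρ t then 0 else rieszKernel α z) ^ b'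
        = if ‖z‖ < ρ t then 0 else ENNReal.ofReal (‖z‖ ^ (-((d - α) * b'))) := fun z => by
      split_ifs
      · exact ENNReal.zero_rpow_of_pos hb'0
      · rw [rieszKernel, ENNReal.ofReal_rpow_of_nonneg (by positivity) hb'0.le,
          ← Real.rpow_mul (norm_nonneg _)]
        congr 2; ring
    simp_rw [h1]
    refine (ENNReal.rpow_le_rpow (hfar (ρ t) (hρ t ht)) (by positivity)).trans ?_
    have := hρ t ht
    rw [ENNReal.ofReal_rpow_of_nonneg (by positivity) (by positivity), ← hρd t ht,
      Real.mul_rpow hB.le (by positivity), ← Real.rpow_mul this.le]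
    refine le_of_eq ?_
    congr 3
    have hb1 : b' * (1 / b') = 1 := mul_one_div_cancel hb'0.ne'
    rw [hdc, sub_mul, mul_assoc, hb1, hinv, ← hd]
    ring
  have hnear' : ∀ t, 0 < t →
      ∫⁻ z : E, (if ‖z‖ < ρ t then rieszKernel α z else 0) ∂μ
        ≤ ENNReal.ofReal (A * (c₀ ^ α * t ^ (1 - e))) := fun t ht => by
    rw [← hρα t ht]; exact hnear (ρ t) (hρ t ht)
  have hnear'' : ∀ t, 0 < t → ENNReal.ofReal (K * t ^ e) *
      ∫⁻ z : E, (if ‖z‖ < ρ t then rieszKernel α z else 0) ∂μ ≤ ENNReal.ofReal (t / 4) := by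
    intro t ht
    refine (mul_le_mul_right (hnear' t ht) _).trans ?_
    rw [← ENNReal.ofReal_mul (by positivity)]
    refine ENNReal.ofReal_le_ofReal (le_of_eq ?_)
    have : t ^ e * t ^ (1 - e) = t := by rw [← Real.rpow_add ht]; simp
    calc _ = K * (A * c₀ ^ α) * (t ^ e * t ^ (1 - e)) := by ring
      _ = _ := by rw [this, hK]; field_simp
  set D : ℝ≥0∞ := ENNReal.ofReal c * ENNReal.ofReal (2 * A * c₀ ^ α) *
    (((ENNReal.ofReal K)⁻¹) ^ (b - 1) / ENNReal.ofReal (c - e)) with hD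
  refine ⟨D, ?_, fun f hf hf1 => ?_⟩
  · refine ENNReal.mul_ne_top (ENNReal.mul_ne_top ENNReal.ofReal_ne_top ENNReal.ofReal_ne_top) ?_
    refine ENNReal.div_ne_top (ENNReal.rpow_ne_top_of_nonneg (by linarith) ?_) ?_
    · simpa using hK0
    · simpa using hce
  let H : ℝ → E → ℝ≥0∞ := fun t y => if ENNReal.ofReal (K * t ^ e) < f y then f y else 0
  let N : ℝ → E → ℝ≥0∞ := fun t z => if ‖z‖ < ρ t then rieszKernel α z else 0
  have hHm : Measurable fun q : ℝ × E => H q.1 q.2 := by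
    refine Measurable.ite (measurableSet_lt (by fun_prop) (by fun_prop)) (by fun_prop) (by fun_prop)
  have hNm : Measurable fun q : ℝ × E => N q.1 q.2 := by
    refine Measurable.ite (measurableSet_lt (by fun_prop) (by fun_prop))
      ((measurable_rieszKernel α).comp measurable_snd) (by fun_prop)
  have hΦm : Measurable fun q : (E × ℝ) × E => N q.1.2 (q.1.1 - q.2) * H q.1.2 q.2 :=
    (hNm.comp (by fun_prop : Measurable fun q : (E × ℝ) × E => (q.1.2, q.1.1 - q.2))).mul
      (hHm.comp (by fun_prop : Measurable fun q : (E × ℝ) × E => (q.1.2, q.2)))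
  have key : ∀ x, (∫⁻ y, rieszKernel α (x - y) * f y ∂μ) ^ c ≤
      ENNReal.ofReal c * ∫⁻ t in Ioi (0 : ℝ), ENNReal.ofReal (2 * t ^ (c - 2)) *
        ∫⁻ y, N t (x - y) * H t y ∂μ := by
    intro x
    set T := ∫⁻ y, rieszKernel α (x - y) * f y ∂μ with hT
    have h1 := lintegral_Ioi_ite_lt_rpow hc T
    have h2 : T ^ c = ENNReal.ofReal c * (T ^ c / ENNReal.ofReal c) := by
      rw [ENNReal.mul_div_cancel (by simpa using hc) ENNReal.ofReal_ne_top]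
    rw [h2, ← h1]
    gcongr ENNReal.ofReal c * ?_
    refine setLIntegral_mono' measurableSet_Ioi fun t ht => ?_
    have ht : 0 < t := ht
    split_ifs with htT
    · have := ofReal_half_le_lintegral_truncated μ (measurable_rieszKernel α) hf hbb ht hf1
        (hfar' t ht) (hnear'' t ht) x htT
      refine le_trans ?_ (mul_le_mul_right this _)
      rw [← ENNReal.ofReal_mul (by positivity)]
      refine ENNReal.ofReal_le_ofReal (le_of_eq ?_)
      have : t ^ (c - 1) = t ^ (c - 2) * t := by
        rw [← Real.rpow_add_one ht.ne']; congr 1; ring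
      rw [this]; ring
    · exact zero_le
  have inner : ∀ t ∈ Ioi (0 : ℝ), ∫⁻ x, ENNReal.ofReal (2 * t ^ (c - 2)) *
        ∫⁻ y, N t (x - y) * H t y ∂μ ∂μ ≤
      ENNReal.ofReal (2 * A * c₀ ^ α) *
        ∫⁻ y, ENNReal.ofReal (t ^ (c - e - 1)) * H t y ∂μ := by
    intro t ht
    have ht : 0 < t := ht
    have hNt : Measurable (N t) := hNm.comp (measurable_prodMk_left)
    have hHt : Measurable (H t) := hHm.comp (measurable_prodMk_left)
    have hm : Measurable fun q : E × E => N t (q.1 - q.2) * H t q.2 :=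
      (hNt.comp (by fun_prop)).mul (hHt.comp (by fun_prop))
    rw [lintegral_const_mul' _ _ ENNReal.ofReal_ne_top,
      lintegral_lintegral_swap hm.aemeasurable]
    have : ∀ y, ∫⁻ x, N t (x - y) * H t y ∂μ ≤
        ENNReal.ofReal (A * (c₀ ^ α * t ^ (1 - e))) * H t y := fun y => by
      have hNy : Measurable fun x => N t (x - y) := hNt.comp (by fun_prop)
      rw [lintegral_mul_const _ hNy,
        lintegral_sub_right_eq_self (N t) y]
      gcongr
      exact hnear' t ht
    refine (mul_le_mul_right (lintegral_mono this) _).trans (le_of_eq ?_)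
    rw [lintegral_const_mul' _ _ ENNReal.ofReal_ne_top,
      lintegral_const_mul' _ _ ENNReal.ofReal_ne_top,
      ← mul_assoc (ENNReal.ofReal _) (ENNReal.ofReal _),
      ← mul_assoc (ENNReal.ofReal (2 * A * c₀ ^ α)) (ENNReal.ofReal _), ← ENNReal.ofReal_mul (by positivity), ← ENNReal.ofReal_mul (by positivity)]
    congr 2
    have : t ^ (c - e - 1) = t ^ (c - 2) * t ^ (1 - e) := by
      rw [← Real.rpow_add ht]; congr 1; ring
    rw [this]; ring
  have last : ∀ y, ∫⁻ t in Ioi (0 : ℝ), ENNReal.ofReal (t ^ (c - e - 1)) * H t y ≤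
      (((ENNReal.ofReal K)⁻¹) ^ (b - 1) / ENNReal.ofReal (c - e)) * f y ^ b := by
    intro y
    set w := ((ENNReal.ofReal K)⁻¹ * f y) ^ e⁻¹ with hw
    calc _ ≤ ∫⁻ t in Ioi (0 : ℝ),
          (if ENNReal.ofReal t < w then ENNReal.ofReal (t ^ (c - e - 1)) else 0) * f y := by
          refine setLIntegral_mono' measurableSet_Ioi fun t ht => ?_
          have ht : 0 < t := ht
          simp only [H]
          split_ifs with h1 h2
          · exact le_rfl
          · refine absurd ?_ h2
            rw [hw, ENNReal.lt_rpow_inv_iff he0, ENNReal.ofReal_rpow_of_pos ht, mul_comm,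
              ← div_eq_mul_inv, ENNReal.lt_div_iff_mul_lt (by simp [hK0]) (by simp),
              ← ENNReal.ofReal_mul (by positivity), mul_comm]
            exact h1
          · simp
          · simp
      _ = w ^ (c - e) / ENNReal.ofReal (c - e) * f y := by
          rw [lintegral_mul_const, lintegral_Ioi_ite_lt_rpow hce]
          exact Measurable.ite (measurableSet_lt (by fun_prop) (by fun_prop)) (by fun_prop)
            (by fun_prop)
      _ = _ := by
          rw [hw, ← ENNReal.rpow_mul, hce', ENNReal.mul_rpow_of_nonneg _ _ (by linarith)]
          have : f y ^ b = f y ^ (b - 1) * f y := by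
            conv_rhs => rw [← ENNReal.rpow_one (f y), ← ENNReal.rpow_mul, one_mul,
              ← ENNReal.rpow_add_of_nonneg _ _ (by linarith) zero_le_one]
            simp
          rw [this, div_eq_mul_inv, div_eq_mul_inv]; ring
  calc _ ≤ ∫⁻ x, (ENNReal.ofReal c * ∫⁻ t in Ioi (0 : ℝ), (ENNReal.ofReal (2 * t ^ (c - 2)) *
        ∫⁻ y, N t (x - y) * H t y ∂μ)) ∂μ := lintegral_mono key
    _ = ENNReal.ofReal c * ∫⁻ t in Ioi (0 : ℝ), ∫⁻ x, ENNReal.ofReal (2 * t ^ (c - 2)) *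
        ∫⁻ y, N t (x - y) * H t y ∂μ ∂μ := by
        rw [lintegral_const_mul' _ _ ENNReal.ofReal_ne_top, lintegral_lintegral_swap]
        refine Measurable.aemeasurable (Measurable.mul ?_ hΦm.lintegral_prod_right')
        fun_prop
    _ ≤ ENNReal.ofReal c * ∫⁻ t in Ioi (0 : ℝ), ENNReal.ofReal (2 * A * c₀ ^ α) *
        ∫⁻ y, ENNReal.ofReal (t ^ (c - e - 1)) * H t y ∂μ := by
        gcongr ENNReal.ofReal c * ?_
        exact setLIntegral_mono' measurableSet_Ioi inner
    _ = ENNReal.ofReal c * (ENNReal.ofReal (2 * A * c₀ ^ α) *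
        ∫⁻ y, (∫⁻ t in Ioi (0 : ℝ), ENNReal.ofReal (t ^ (c - e - 1)) * H t y) ∂μ) := by
        rw [lintegral_const_mul' _ _ ENNReal.ofReal_ne_top, lintegral_lintegral_swap]
        exact Measurable.aemeasurable (Measurable.mul (by fun_prop) hHm)
    _ ≤ ENNReal.ofReal c * (ENNReal.ofReal (2 * A * c₀ ^ α) *
        ((((ENNReal.ofReal K)⁻¹) ^ (b - 1) / ENNReal.ofReal (c - e)) * 1)) := by
        gcongr ENNReal.ofReal c * (_ * ?_)
        refine (lintegral_mono last).trans ?_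
        rw [lintegral_const_mul _ (by fun_prop)]
        gcongr
    _ = D := by rw [hD]; ring

/-- The **Hardy–Littlewood–Sobolev inequality** for the Riesz potential. -/
theorem exists_lintegral_rieszKernel_rpow_le [Nontrivial E] {α b c : ℝ} (hα : 0 < α)
    (hb : 1 < b) (hc : 0 < c) (hbc : 1 / c = 1 / b - α / finrank ℝ E) :
    ∃ C : ℝ≥0∞, C ≠ ⊤ ∧ ∀ f : E → ℝ≥0∞, Measurable f →
      (∫⁻ x, (∫⁻ y, rieszKernel α (x - y) * f y ∂μ) ^ c ∂μ) ^ (1 / c)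
        ≤ C * (∫⁻ y, f y ^ b ∂μ) ^ (1 / b) := by
  obtain ⟨C, hC, h⟩ := exists_lintegral_rieszKernel_rpow_le_of_le_one μ hα hb hc hbc
  have hb0 : 0 < b := by linarith
  refine ⟨(C + 1) ^ (1 / c), ENNReal.rpow_ne_top_of_nonneg (by positivity) (by simp [hC]),
    fun f hf => ?_⟩
  set M := (∫⁻ y, f y ^ b ∂μ) ^ (1 / b) with hM
  have hMb : ∫⁻ y, f y ^ b ∂μ = M ^ b := by
    rw [hM, ← ENNReal.rpow_mul, one_div_mul_cancel hb0.ne', ENNReal.rpow_one]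
  rcases eq_or_ne M 0 with h0 | h0
  · rw [h0, ENNReal.zero_rpow_of_pos hb0, lintegral_eq_zero_iff (by fun_prop)] at hMb
    have hf0 : f =ᵐ[μ] 0 := by
      filter_upwards [hMb] with y hy
      simpa [hb0, hb0.not_gt] using hy
    have hT : ∀ x, ∫⁻ y, rieszKernel α (x - y) * f y ∂μ = 0 := fun x => by
      rw [lintegral_congr_ae (g := 0)]
      · simp
      · filter_upwards [hf0] with y hy
        simp [hy]
    simp [hT, hc]
  rcases eq_or_ne M ⊤ with h1 | h1
  · rw [h1, ENNReal.mul_top]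
    · exact le_top
    · simp [hc.not_gt, hc]
  have hg := h (fun y => M⁻¹ * f y) (by fun_prop) (by
    simp_rw [ENNReal.mul_rpow_of_nonneg _ _ hb0.le]
    rw [lintegral_const_mul _ (by fun_prop), hMb, ← ENNReal.mul_rpow_of_nonneg _ _ hb0.le,
      ENNReal.inv_mul_cancel h0 h1, ENNReal.one_rpow])
  have hT : ∀ x, ∫⁻ y, rieszKernel α (x - y) * (M⁻¹ * f y) ∂μ
      = M⁻¹ * ∫⁻ y, rieszKernel α (x - y) * f y ∂μ := fun x => by
    rw [← lintegral_const_mul' _ _ (by simpa using h0)]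
    exact lintegral_congr fun y => by ring
  simp_rw [hT, ENNReal.mul_rpow_of_nonneg _ _ hc.le] at hg
  rw [lintegral_const_mul' _ _ (ENNReal.rpow_ne_top_of_nonneg hc.le (by simpa using h0))] at hg
  have h2 := ENNReal.rpow_le_rpow (hg.trans le_self_add : _ ≤ C + 1)
    (by positivity : 0 ≤ 1 / c)
  rw [ENNReal.mul_rpow_of_nonneg _ _ (by positivity), ← ENNReal.rpow_mul,
    mul_one_div_cancel hc.ne', ENNReal.rpow_one] at h2
  rw [mul_comm]
  rwa [ENNReal.inv_mul_le_iff h0 h1] at h2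
end

section
variable {E : Type*} [NormedAddCommGroup E] [NormedSpace ℝ E] [FiniteDimensional ℝ E]
  [MeasurableSpace E] [BorelSpace E] (μ : Measure E) [μ.IsAddHaarMeasure]
  {F : Type*} [NormedAddCommGroup F] [NormedSpace ℝ F]

theorem enorm_inv_mul_enorm_le_lintegral_ray [CompleteSpace F] {u : E → F} (hu : ContDiff ℝ 1 u)
    (hc : HasCompactSupport u) {x : E} (hx : x ≠ 0) :
    ‖x‖ₑ⁻¹ * ‖u x‖ₑ ≤ ∫⁻ t in Ioi (1 : ℝ), ‖fderiv ℝ u (t • x)‖ₑ := by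
  have hx0 : ‖x‖ₑ ≠ 0 := by simpa using hx
  rw [ENNReal.inv_mul_le_iff hx0 enorm_ne_top]
  obtain ⟨R, hR⟩ := hc.isCompact.isBounded.exists_norm_le
  have hxn : 0 < ‖x‖ := norm_pos_iff.2 hx
  set T := max 1 ((|R| + 1) / ‖x‖) with hT
  have hT1 : 1 ≤ T := le_max_left _ _
  have huT : u (T • x) = 0 := by
    by_contra h
    have h1 := hR (T • x) (subset_tsupport _ h)
    rw [norm_smul, Real.norm_of_nonneg (by linarith)] at h1
    have h2 : (|R| + 1) / ‖x‖ ≤ T := le_max_right _ _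
    rw [div_le_iff₀ hxn] at h2
    linarith [le_abs_self R]
  have hcont : Continuous fun t : ℝ => fderiv ℝ u (t • x) x :=
    ((hu.continuous_fderiv one_ne_zero).comp (by fun_prop)).clm_apply continuous_const
  have hderiv : ∀ t ∈ uIcc 1 T, HasDerivAt (fun t : ℝ => u (t • x)) (fderiv ℝ u (t • x) x) t := by
    intro t _
    have h1 : HasFDerivAt u (fderiv ℝ u (t • x)) (t • x) :=
      (hu.differentiable one_ne_zero _).hasFDerivAt
    have h2 : HasDerivAt (fun t : ℝ => t • x) x t := by
      simpa using (hasDerivAt_id t).smul_const x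
    exact h1.comp_hasDerivAt t h2
  have hftc := intervalIntegral.integral_eq_sub_of_hasDerivAt hderiv
    (hcont.intervalIntegrable _ _)
  simp only [huT, one_smul, zero_sub] at hftc
  rw [← enorm_neg, ← hftc, intervalIntegral.integral_of_le hT1]
  refine (enorm_integral_le_lintegral_enorm _).trans ?_
  rw [← lintegral_const_mul' _ _ enorm_ne_top]
  refine (lintegral_mono_set Ioc_subset_Ioi_self).trans (lintegral_mono fun t => ?_)
  rw [mul_comm]
  exact ContinuousLinearMap.le_opENorm _ _

/-- **Hardy's inequality** in `L^r`, for `1 < r < d`. -/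
theorem exists_lintegral_hardy_le [CompleteSpace F] {r : ℝ} (hr1 : 1 < r)
    (hrd : r < finrank ℝ E) :
    ∃ C : ℝ≥0∞, C ≠ ⊤ ∧ ∀ u : E → F, ContDiff ℝ 1 u → HasCompactSupport u →
      ∫⁻ x, (‖x‖ₑ⁻¹ * ‖u x‖ₑ) ^ r ∂μ ≤ C * ∫⁻ x, ‖fderiv ℝ u x‖ₑ ^ r ∂μ := by
  have hr0 : 0 < r := by linarith
  set d : ℝ := ((finrank ℝ E : ℕ) : ℝ) with hd
  have : Nontrivial E := by
    apply Module.nontrivial_of_finrank_pos (R := ℝ)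
    have : (0 : ℝ) < finrank ℝ E := by linarith
    exact_mod_cast this
  set r' := r.conjExponent
  have hrr : r.HolderConjugate r' := Real.HolderConjugate.conjExponent hr1
  have hr'0 : 0 < r' := hrr.symm.pos
  have hinv : 1 / r' = 1 - 1 / r := by
    have := hrr.inv_add_inv_eq_one; rw [one_div, one_div]; linarith
  set γ := (r + d - 2) / (2 * r) with hγ
  have hγr : γ * r = (r + d - 2) / 2 := by rw [hγ]; field_simp
  have hγr' : 1 < γ * r' := by
    have : 1 / r' < γ := by
      rw [hinv, lt_div_iff₀ (by positivity)]
      have : (1 - 1 / r) * (2 * r) = 2 * r - 2 := by field_simp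
      linarith
    rwa [div_lt_iff₀ hr'0] at this
  have hfin : ∀ q : ℝ, q < -1 → ∫⁻ t in Ioi (1 : ℝ), ENNReal.ofReal (t ^ q) ≠ ⊤ := by
    intro q hq
    have := (integrableOn_Ioi_rpow_of_lt hq one_pos).lintegral_lt_top
    exact this.ne
  set C₁ := ∫⁻ t in Ioi (1 : ℝ), ENNReal.ofReal (t ^ (-(γ * r')))
  set C₂ := ∫⁻ t in Ioi (1 : ℝ), ENNReal.ofReal (t ^ (γ * r - d))
  have hC₁ : C₁ ≠ ⊤ := hfin _ (by linarith)
  have hC₂ : C₂ ≠ ⊤ := hfin _ (by linarith)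
  refine ⟨(C₁ ^ (1 / r')) ^ r * C₂, ENNReal.mul_ne_top (ENNReal.rpow_ne_top_of_nonneg hr0.le
    (ENNReal.rpow_ne_top_of_nonneg (by positivity) hC₁)) hC₂, fun u hu hc => ?_⟩
  set G : E → ℝ≥0∞ := fun x => ‖fderiv ℝ u x‖ₑ with hG
  have hGc : Continuous G := (hu.continuous_fderiv one_ne_zero).enorm
  have hray : ∀ x, (∫⁻ t in Ioi (1 : ℝ), G (t • x)) ^ r ≤ (C₁ ^ (1 / r')) ^ r *
      ∫⁻ t in Ioi (1 : ℝ), ENNReal.ofReal (t ^ (γ * r)) * G (t • x) ^ r := by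
    intro x
    have h1 : ∫⁻ t in Ioi (1 : ℝ), G (t • x) = ∫⁻ t in Ioi (1 : ℝ),
        ENNReal.ofReal (t ^ (-γ)) * (ENNReal.ofReal (t ^ γ) * G (t • x)) := by
      refine setLIntegral_congr_fun measurableSet_Ioi fun t ht => ?_
      have ht : 0 < t := lt_trans one_pos ht
      rw [← mul_assoc, ← ENNReal.ofReal_mul (by positivity), ← Real.rpow_add ht]
      simp
    have hGx : Measurable fun t : ℝ => G (t • x) := (hGc.comp (by fun_prop)).measurable
    have h2 := ENNReal.lintegral_mul_le_Lp_mul_Lq (volume.restrict (Ioi (1 : ℝ))) hrr.symm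
      (f := fun t => ENNReal.ofReal (t ^ (-γ))) (g := fun t => ENNReal.ofReal (t ^ γ) * G (t • x))
      (by fun_prop) (by fun_prop)
    have h3 : ∫⁻ t in Ioi (1 : ℝ), ENNReal.ofReal (t ^ (-γ)) ^ r' = C₁ := by
      refine setLIntegral_congr_fun measurableSet_Ioi fun t ht => ?_
      have ht : 0 < t := lt_trans one_pos ht
      rw [ENNReal.ofReal_rpow_of_pos (by positivity), ← Real.rpow_mul ht.le, neg_mul]
    have h4 : ∫⁻ t in Ioi (1 : ℝ), (ENNReal.ofReal (t ^ γ) * G (t • x)) ^ r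
        = ∫⁻ t in Ioi (1 : ℝ), ENNReal.ofReal (t ^ (γ * r)) * G (t • x) ^ r := by
      refine setLIntegral_congr_fun measurableSet_Ioi fun t ht => ?_
      have ht : 0 < t := lt_trans one_pos ht
      rw [ENNReal.mul_rpow_of_nonneg _ _ hr0.le, ENNReal.ofReal_rpow_of_pos (by positivity),
        ← Real.rpow_mul ht.le]
    rw [h3, h4] at h2
    rw [h1]
    refine (ENNReal.rpow_le_rpow h2 hr0.le).trans (le_of_eq ?_)
    rw [ENNReal.mul_rpow_of_nonneg _ _ hr0.le]
    congr 1
    rw [← ENNReal.rpow_mul, one_div_mul_cancel hr0.ne', ENNReal.rpow_one]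
  have hae : ∀ᵐ x ∂μ, x ≠ 0 := by
    simp [ae_iff]
  calc ∫⁻ x, (‖x‖ₑ⁻¹ * ‖u x‖ₑ) ^ r ∂μ
      ≤ ∫⁻ x, (C₁ ^ (1 / r')) ^ r *
      ∫⁻ t in Ioi (1 : ℝ), ENNReal.ofReal (t ^ (γ * r)) * G (t • x) ^ r ∂volume ∂μ := by
        refine lintegral_mono_ae ?_
        filter_upwards [hae] with x hx
        exact (ENNReal.rpow_le_rpow (enorm_inv_mul_enorm_le_lintegral_ray hu hc hx) hr0.le).trans
          (hray x)
    _ = (C₁ ^ (1 / r')) ^ r * ∫⁻ t in Ioi (1 : ℝ),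
        (∫⁻ x, ENNReal.ofReal (t ^ (γ * r)) * G (t • x) ^ r ∂μ) := by
        rw [lintegral_const_mul' _ _ (ENNReal.rpow_ne_top_of_nonneg hr0.le
          (ENNReal.rpow_ne_top_of_nonneg (by positivity) hC₁)), lintegral_lintegral_swap]
        have : Measurable fun q : E × ℝ => G (q.2 • q.1) := (hGc.comp (by fun_prop)).measurable
        exact Measurable.aemeasurable (Measurable.mul (by fun_prop) (by fun_prop))
    _ = (C₁ ^ (1 / r')) ^ r * ∫⁻ t in Ioi (1 : ℝ),
        ENNReal.ofReal (t ^ (γ * r - d)) * ∫⁻ x, G x ^ r ∂μ := by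
        congr 1
        refine setLIntegral_congr_fun measurableSet_Ioi fun t ht => ?_
        have ht : 0 < t := lt_trans one_pos ht
        rw [lintegral_const_mul' _ _ ENNReal.ofReal_ne_top,
          lintegral_comp_smul_addHaar μ (fun x => G x ^ r) ht, ← mul_assoc,
          ← ENNReal.ofReal_mul (by positivity), ← Real.rpow_add ht, sub_eq_add_neg]
    _ = _ := by
        rw [lintegral_mul_const _ (by fun_prop), mul_assoc]

/-- The **Sobolev inequality** written with lower Lebesgue integrals. -/
theorem exists_lintegral_sobolev_le [FiniteDimensional ℝ F] {r s : ℝ} (hr1 : 1 ≤ r) (hs : 0 < s)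
    (hd : 0 < finrank ℝ E) (hrs : 1 / s = 1 / r - 1 / finrank ℝ E) :
    ∃ C : ℝ≥0∞, C ≠ ⊤ ∧ ∀ u : E → F, ContDiff ℝ 1 u → HasCompactSupport u →
      (∫⁻ x, ‖u x‖ₑ ^ s ∂μ) ^ (1 / s) ≤ C * (∫⁻ x, ‖fderiv ℝ u x‖ₑ ^ r ∂μ) ^ (1 / r) := by
  have hr0 : 0 < r := by linarith
  refine ⟨SNormLESNormFDerivOfEqConst F μ (r.toNNReal), ENNReal.coe_ne_top, fun u hu hc => ?_⟩
  have h := eLpNorm_le_eLpNorm_fderiv_of_eq μ hu hc (p := r.toNNReal) (p' := s.toNNReal)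
    (by simpa using hr1) hd (by
      simpa [one_div, Real.coe_toNNReal _ hr0.le, Real.coe_toNNReal _ hs.le] using hrs)
  rw [eLpNorm_eq_lintegral_rpow_enorm_toReal (by simpa using hs) (by simp),
    eLpNorm_eq_lintegral_rpow_enorm_toReal (by simpa using hr0) (by simp)] at h
  simpa [Real.coe_toNNReal _ hr0.le, Real.coe_toNNReal _ hs.le] using h

/-- Interpolation between the Hardy and the Sobolev inequalities: a weighted bound for a power
of `u`. -/
theorem exists_lintegral_hardy_sobolev_le [FiniteDimensional ℝ F] {r a τ κ : ℝ}
    (hr1 : 1 < r) (hrd : r < finrank ℝ E) (hτ : 0 < τ) (hκ : 0 < κ) (ha : 0 < a)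
    (h : 1 / a = τ / r + κ * (1 / r - 1 / finrank ℝ E)) :
    ∃ C : ℝ≥0∞, C ≠ ⊤ ∧ ∀ u : E → F, ContDiff ℝ 1 u → HasCompactSupport u →
      (∫⁻ x, ((‖x‖ₑ⁻¹ * ‖u x‖ₑ) ^ τ * ‖u x‖ₑ ^ κ) ^ a ∂μ) ^ (1 / a)
        ≤ C * ((∫⁻ x, ‖fderiv ℝ u x‖ₑ ^ r ∂μ) ^ (1 / r)) ^ (τ + κ) := by
  have hr0 : 0 < r := by linarith
  have hd : (0 : ℝ) < finrank ℝ E := by linarith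
  have hsob : 0 < 1 / r - 1 / (finrank ℝ E : ℝ) := by
    rw [sub_pos]; exact one_div_lt_one_div_of_lt hr0 hrd
  obtain ⟨s, hs0, hs1⟩ : ∃ s : ℝ, 0 < s ∧ 1 / s = 1 / r - 1 / (finrank ℝ E : ℝ) :=
    ⟨1 / (1 / r - 1 / (finrank ℝ E : ℝ)), by positivity, one_div_one_div _⟩
  obtain ⟨C₁, hC₁, H₁⟩ := exists_lintegral_hardy_le (F := F) μ hr1 hrd
  obtain ⟨C₂, hC₂, H₂⟩ := exists_lintegral_sobolev_le (F := F) μ hr1.le hs0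
    (by exact_mod_cast hd) hs1
  refine ⟨C₁ ^ (τ / r) * C₂ ^ κ, ENNReal.mul_ne_top
    (ENNReal.rpow_ne_top_of_nonneg (by positivity) hC₁)
    (ENNReal.rpow_ne_top_of_nonneg hκ.le hC₂), fun u hu hc => ?_⟩
  rw [← hs1] at h
  have hlt : a < r / τ := by
    rw [lt_div_iff₀ hτ]
    have h1 : a * (1 / a) = 1 := mul_one_div_cancel ha.ne'
    have h2 : 0 < a * (κ * (1 / s)) := by positivity
    have h3 : a * (τ / r) < 1 := by rw [h, mul_add] at h1; linarith
    rw [mul_div_assoc', div_lt_one hr0] at h3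
    exact h3
  have hum' : Measurable fun x => ‖u x‖ₑ := hu.continuous.enorm.measurable
  have hH := ENNReal.lintegral_Lp_mul_le_Lq_mul_Lr ha hlt (r := s / κ)
    (by rw [h, one_div_div, one_div_div]; field_simp) μ
    (f := fun x => (‖x‖ₑ⁻¹ * ‖u x‖ₑ) ^ τ) (g := fun x => ‖u x‖ₑ ^ κ)
    (by fun_prop) (hum'.pow_const κ).aemeasurable
  refine hH.trans ?_
  simp only [← ENNReal.rpow_mul, mul_div_cancel₀ r hτ.ne', mul_div_cancel₀ s hκ.ne', one_div_div]
  have e1 := ENNReal.rpow_le_rpow (H₁ u hu hc) (by positivity : 0 ≤ τ / r)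
  have e2 := ENNReal.rpow_le_rpow (H₂ u hu hc) hκ.le
  rw [← ENNReal.rpow_mul, one_div_mul_eq_div] at e2
  refine (mul_le_mul' e1 e2).trans (le_of_eq ?_)
  rw [ENNReal.mul_rpow_of_nonneg _ _ (by positivity), ENNReal.mul_rpow_of_nonneg _ _ hκ.le,
    ← ENNReal.rpow_mul, mul_add, ENNReal.rpow_add_of_nonneg _ _ (by positivity) (by positivity),
    one_div_mul_eq_div]
  ring_nf
end

section
variable {E : Type*} [NormedAddCommGroup E] [NormedSpace ℝ E] [FiniteDimensional ℝ E]
  [MeasurableSpace E] [BorelSpace E] (μ : Measure E) [μ.IsAddHaarMeasure]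
  {F : Type*} [NormedAddCommGroup F] [NormedSpace ℝ F]

/-- The nonlinear estimate with lower Lebesgue integrals and abstract exponents. -/
theorem exists_lintegral_weighted_rieszKernel_le [FiniteDimensional ℝ F]
    {α τ κ r a b c m : ℝ} (hα : 0 < α) (hr1 : 1 < r) (hrd : r < finrank ℝ E) (hτ : 0 < τ)
    (hκ : 0 < κ) (ha : 0 < a) (hb : 1 < b) (hc : 0 < c) (hm : 0 < m)
    (hra : 1 / a = τ / r + κ * (1 / r - 1 / finrank ℝ E)) (hab : 1 / b = 1 / a + 1 / r)
    (hbc : 1 / c = 1 / b - α / finrank ℝ E) (hac : 1 / m = 1 / a + 1 / c) :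
    ∃ C : ℝ≥0∞, C ≠ ⊤ ∧ ∀ u : E → F, ContDiff ℝ 1 u → HasCompactSupport u →
      (∫⁻ x, ((‖x‖ₑ⁻¹ * ‖u x‖ₑ) ^ τ * ‖u x‖ₑ ^ κ * ∫⁻ y, rieszKernel α (x - y) *
        ((‖y‖ₑ⁻¹ * ‖u y‖ₑ) ^ τ * ‖u y‖ₑ ^ κ * ‖fderiv ℝ u y‖ₑ) ∂μ) ^ m ∂μ) ^ (1 / m)
        ≤ C * ((∫⁻ x, ‖fderiv ℝ u x‖ₑ ^ r ∂μ) ^ (1 / r)) ^ (2 * (τ + κ) + 1) := by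
  have hr0 : 0 < r := by linarith
  have hb0 : 0 < b := by linarith
  have : Nontrivial E := by
    apply Module.nontrivial_of_finrank_pos (R := ℝ)
    have : (0 : ℝ) < finrank ℝ E := by linarith
    exact_mod_cast this
  obtain ⟨C₁, hC₁, H₁⟩ := exists_lintegral_hardy_sobolev_le (F := F) μ hr1 hrd hτ hκ ha hra
  obtain ⟨C₂, hC₂, H₂⟩ := exists_lintegral_rieszKernel_rpow_le μ hα hb hc hbc
  refine ⟨C₁ * (C₂ * C₁), ENNReal.mul_ne_top hC₁ (ENNReal.mul_ne_top hC₂ hC₁),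
    fun u hu hcs => ?_⟩
  have hum : Measurable fun x => ‖u x‖ₑ := hu.continuous.enorm.measurable
  have hGm : Measurable fun x => ‖fderiv ℝ u x‖ₑ :=
    (hu.continuous_fderiv one_ne_zero).enorm.measurable
  let W : E → ℝ≥0∞ := fun x => (‖x‖ₑ⁻¹ * ‖u x‖ₑ) ^ τ * ‖u x‖ₑ ^ κ
  have hWm : Measurable W := Measurable.mul (by fun_prop) (hum.pow_const κ)
  let T : E → ℝ≥0∞ := fun x => ∫⁻ y, rieszKernel α (x - y) * (W y * ‖fderiv ℝ u y‖ₑ) ∂μ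
  have hTm : Measurable T := by
    have : Measurable fun q : E × E =>
        rieszKernel α (q.1 - q.2) * (W q.2 * ‖fderiv ℝ u q.2‖ₑ) :=
      ((measurable_rieszKernel α).comp (by fun_prop : Measurable fun q : E × E => q.1 - q.2)).mul
        ((hWm.mul hGm).comp measurable_snd)
    exact this.lintegral_prod_right'
  set V := (∫⁻ x, ‖fderiv ℝ u x‖ₑ ^ r ∂μ) ^ (1 / r) with hV
  have hma : m < a := by
    refine lt_of_one_div_lt_one_div ha ?_
    have : 0 < 1 / c := by positivity
    linarith
  have hba : b < a := by
    refine lt_of_one_div_lt_one_div ha ?_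
    have : 0 < 1 / r := by positivity
    linarith
  have h1 := ENNReal.lintegral_Lp_mul_le_Lq_mul_Lr hm hma hac μ hWm.aemeasurable hTm.aemeasurable
  have h2 := H₁ u hu hcs
  have h3 := H₂ (fun y => W y * ‖fderiv ℝ u y‖ₑ) (hWm.mul hGm)
  have h4 := ENNReal.lintegral_Lp_mul_le_Lq_mul_Lr hb0 hba hab μ hWm.aemeasurable hGm.aemeasurable
  refine h1.trans ?_
  calc (∫⁻ x, W x ^ a ∂μ) ^ (1 / a) * (∫⁻ x, T x ^ c ∂μ) ^ (1 / c)
      ≤ (C₁ * V ^ (τ + κ)) * (C₂ * ((C₁ * V ^ (τ + κ)) * V)) := by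
        refine mul_le_mul' h2 (h3.trans (mul_le_mul_right (h4.trans ?_) _))
        exact mul_le_mul' h2 le_rfl
    _ = C₁ * (C₂ * C₁) * (V ^ (τ + κ) * V ^ (τ + κ) * V ^ (1 : ℝ)) := by
        rw [ENNReal.rpow_one]; ring
    _ = _ := by
        rw [← ENNReal.rpow_add_of_nonneg _ _ (by positivity) (by positivity),
          ← ENNReal.rpow_add_of_nonneg _ _ (by positivity) (by positivity), two_mul]
end

theorem ofReal_integral_le_lintegral_ofReal {X : Type*} [MeasurableSpace X] (μ : Measure X)
    {f : X → ℝ} (hf : ∀ x, 0 ≤ f x) :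
    ENNReal.ofReal (∫ x, f x ∂μ) ≤ ∫⁻ x, ENNReal.ofReal (f x) ∂μ := by
  have := enorm_integral_le_lintegral_enorm (μ := μ) f
  rw [Real.enorm_of_nonneg (integral_nonneg hf)] at this
  simpa only [Real.enorm_of_nonneg (hf _)] using this

theorem ofReal_norm_rpow_mul_le {E F : Type*} [NormedAddCommGroup E] [NormedAddCommGroup F]
    {τ κ q : ℝ} (hτ : 0 < τ) (hκ : 0 < κ) (hq : q = τ + κ) (x : E) (v : F) :
    ENNReal.ofReal (‖x‖ ^ (-τ) * ‖v‖ ^ q) ≤ (‖x‖ₑ⁻¹ * ‖v‖ₑ) ^ τ * ‖v‖ₑ ^ κ := by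
  rcases eq_or_ne x 0 with rfl | hx
  · simp [Real.zero_rpow (neg_ne_zero.2 hτ.ne')]
  have hx : 0 < ‖x‖ := norm_pos_iff.2 hx
  refine le_of_eq ?_
  rw [ENNReal.ofReal_mul (by positivity), ← ENNReal.ofReal_rpow_of_pos hx,
    ← ENNReal.ofReal_rpow_of_nonneg (norm_nonneg _) (by linarith), ofReal_norm, ofReal_norm,
    ENNReal.mul_rpow_of_nonneg _ _ hτ.le, hq, ENNReal.rpow_add_of_nonneg _ _ hτ.le hκ.le,
    ENNReal.rpow_neg, ENNReal.inv_rpow, mul_assoc]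

/-- Nonlinear estimate, term A₄ in Lemma 3.1:
`‖ |x|^{-τ} |u|^{p-1} (I_α * (|·|^{-τ}|u|^{p-1}|∇u|)) ‖_{L^{2n/(n+2)}} ≤ C ‖∇u‖_{L^r}^{2p-1}`. -/
theorem nonlinear_estimate_A4 (n : ℕ) (hn : 3 ≤ n) (α τ p r : ℝ)
    (hα0 : 0 < α) (hαn : α < n) (hτ0 : 0 < τ)
    (hp : p = 1 + (2 - 2 * τ + α) / ((n : ℝ) - 2)) (hp2 : 2 < p) (hτp : τ ≤ p - 2)
    (hr1 : 1 < r) (hr : (n : ℝ) / r = (n : ℝ) / 2 - 1 / (2 * p - 1))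
    (hrlow : 1 < (n : ℝ) / r)
    (hrhigh : (n : ℝ) / r < min ((p - τ - 2 + n) / (p - 1)) ((p - τ - 1 + n) / p)) :
    ∃ C : ℝ, 0 < C ∧ ∀ u : EuclideanSpace ℝ (Fin n) → ℂ,
      ContDiff ℝ (⊤ : ℕ∞) u → HasCompactSupport u →
      (∫ x, (‖x‖ ^ (-τ) * ‖u x‖ ^ (p - 1)
              * ∫ y, ‖x - y‖ ^ (α - (n : ℝ))
                  * (‖y‖ ^ (-τ) * ‖u y‖ ^ (p - 1) * ‖fderiv ℝ u y‖))
            ^ (2 * (n : ℝ) / ((n : ℝ) + 2))) ^ (((n : ℝ) + 2) / (2 * (n : ℝ)))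
        ≤ C * ((∫ x, ‖fderiv ℝ u x‖ ^ r) ^ (1 / r)) ^ (2 * p - 1) := by
  have hn3 : (3 : ℝ) ≤ n := by exact_mod_cast hn
  have hn0 : (0 : ℝ) < n := by linarith
  have hr0 : 0 < r := by linarith
  have hfr : finrank ℝ (EuclideanSpace ℝ (Fin n)) = n := finrank_euclideanSpace_fin
  have hrn : r < n := by rwa [one_lt_div hr0] at hrlow
  obtain ⟨R, hR⟩ : ∃ R : ℝ, (n : ℝ) / r = R := ⟨_, rfl⟩
  have hRr : 1 / r = R / n := by rw [← hR]; field_simp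
  rw [hR] at hr hrlow hrhigh
  have hscale : (p - 1) * ((n : ℝ) - 2) = 2 - 2 * τ + α := by
    have : (n : ℝ) - 2 ≠ 0 := by linarith
    rw [hp]; field_simp; ring
  have hRp : (2 * p - 1) * R = (2 * p - 1) * n / 2 - 1 := by
    have : 2 * p - 1 ≠ 0 := by linarith
    rw [hr]; field_simp
  have hRsmall : (n : ℝ) / 2 - 1 < R := by
    rw [hr]
    have : 1 / (2 * p - 1) < 1 := by rw [div_lt_one] <;> linarith
    linarith
  have hRp2 : R * p < p - τ - 1 + n :=
    (lt_div_iff₀ (by linarith)).1 (hrhigh.trans_le (min_le_right _ _))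
  have hκ : 0 < p - 1 - τ := by linarith
  obtain ⟨a', ha'⟩ : ∃ a' : ℝ, a' = τ + (p - 1) * (R - 1) := ⟨_, rfl⟩
  have ha'0 : 0 < a' := by rw [ha']; nlinarith
  have hc'0 : 0 < a' + R - α := by rw [ha']; nlinarith
  obtain ⟨a, b, c, haa, hbb, hcc⟩ :
      ∃ a b c : ℝ, a = n / a' ∧ b = n / (a' + R) ∧ c = n / (a' + R - α) := ⟨_, _, _, rfl, rfl, rfl⟩
  obtain ⟨C, hC, H⟩ := exists_lintegral_weighted_rieszKernel_le (F := ℂ)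
    (volume : Measure (EuclideanSpace ℝ (Fin n))) (α := α) (τ := τ) (κ := p - 1 - τ) (r := r)
    (a := a) (b := b) (c := c) (m := 2 * (n : ℝ) / ((n : ℝ) + 2))
    hα0 hr1 (by rwa [hfr]) hτ0 hκ (by rw [haa]; positivity)
    (by
      rw [hbb, one_lt_div (by linarith), ha']
      linarith)
    (by rw [hcc]; positivity) (by positivity)
    (by
      rw [hfr, haa, one_div_div, div_eq_mul_one_div τ, hRr, ha']
      field_simp
      ring)
    (by
      rw [haa, hbb, one_div_div, one_div_div, hRr]
      ring)
    (by
      rw [hcc, hbb, one_div_div, one_div_div, hfr]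
      ring)
    (by
      rw [haa, hcc, one_div_div, one_div_div, one_div_div, ← add_div,
        div_eq_div_iff (by positivity) hn0.ne']
      have : 2 * (a' + (a' + R - α)) = n + 2 := by rw [ha']; linarith
      linear_combination (-(n : ℝ)) * this)
  rw [show 2 * (τ + (p - 1 - τ)) + 1 = 2 * p - 1 by ring] at H
  refine ⟨C.toReal + 1, by positivity, fun u hu hcs => ?_⟩
  have hu1 : ContDiff ℝ 1 u := hu.of_le (by exact_mod_cast le_top)
  have hint : Integrable fun x => ‖fderiv ℝ u x‖ ^ r := by
    refine Continuous.integrable_of_hasCompactSupport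
      ((hu1.continuous_fderiv one_ne_zero).norm.rpow_const fun _ => Or.inr hr0.le) ?_
    exact (hcs.fderiv ℝ).comp_left (g := fun v => ‖v‖ ^ r) (by simp [hr0.ne'])
  have hV : (∫⁻ x, ‖fderiv ℝ u x‖ₑ ^ r) ^ (1 / r)
      = ENNReal.ofReal ((∫ x, ‖fderiv ℝ u x‖ ^ r) ^ (1 / r)) := by
    rw [← ENNReal.ofReal_rpow_of_nonneg (integral_nonneg fun x => by positivity) (by positivity),
      ofReal_integral_eq_lintegral_ofReal hint (Filter.Eventually.of_forall fun x => by positivity)]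
    congr 1
    refine lintegral_congr fun x => ?_
    rw [← ENNReal.ofReal_rpow_of_nonneg (norm_nonneg _) hr0.le, ofReal_norm]
  have hmain := H u hu1 hcs
  rw [hV] at hmain
  set V := (∫ x, ‖fderiv ℝ u x‖ ^ r) ^ (1 / r)
  have hV0 : 0 ≤ V := Real.rpow_nonneg (integral_nonneg fun x => by positivity) _
  have hw := ofReal_norm_rpow_mul_le (E := EuclideanSpace ℝ (Fin n)) (F := ℂ) hτ0 hκ
    (q := p - 1) (by ring)
  have hinner : ∀ x, ENNReal.ofReal (∫ y, ‖x - y‖ ^ (α - (n : ℝ))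
      * (‖y‖ ^ (-τ) * ‖u y‖ ^ (p - 1) * ‖fderiv ℝ u y‖)) ≤ ∫⁻ y, rieszKernel α (x - y) *
        ((‖y‖ₑ⁻¹ * ‖u y‖ₑ) ^ τ * ‖u y‖ₑ ^ (p - 1 - τ) * ‖fderiv ℝ u y‖ₑ) := fun x => by
    refine (ofReal_integral_le_lintegral_ofReal _ fun y => by positivity).trans
      (lintegral_mono fun y => ?_)
    rw [ENNReal.ofReal_mul (by positivity), ENNReal.ofReal_mul (by positivity), ofReal_norm,
      rieszKernel, hfr]
    gcongr
    exact hw y (u y)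
  have hinner0 : ∀ x, 0 ≤ ∫ y, ‖x - y‖ ^ (α - (n : ℝ))
      * (‖y‖ ^ (-τ) * ‖u y‖ ^ (p - 1) * ‖fderiv ℝ u y‖) :=
    fun x => integral_nonneg fun y => by positivity
  have houter0 : ∀ x, 0 ≤ ‖x‖ ^ (-τ) * ‖u x‖ ^ (p - 1) * ∫ y, ‖x - y‖ ^ (α - (n : ℝ))
      * (‖y‖ ^ (-τ) * ‖u y‖ ^ (p - 1) * ‖fderiv ℝ u y‖) :=
    fun x => mul_nonneg (by positivity) (hinner0 x)
  rw [← ENNReal.ofReal_le_ofReal_iff (by positivity),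
    ← ENNReal.ofReal_rpow_of_nonneg (integral_nonneg fun x => Real.rpow_nonneg (houter0 x) _)
      (by positivity)]
  rw [one_div_div] at hmain
  refine (ENNReal.rpow_le_rpow ((ofReal_integral_le_lintegral_ofReal _ fun x =>
    Real.rpow_nonneg (houter0 x) _).trans (lintegral_mono fun x => ?_)) (by positivity)).trans
    (hmain.trans ?_)
  · rw [← ENNReal.ofReal_rpow_of_nonneg (houter0 x) (by positivity)]
    refine ENNReal.rpow_le_rpow ?_ (by positivity)
    rw [ENNReal.ofReal_mul (by positivity)]
    exact mul_le_mul' (hw x (u x)) (hinner x)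
  · rw [ENNReal.ofReal_mul (by positivity), ENNReal.ofReal_rpow_of_nonneg hV0 (by linarith)]
    gcongr
    rw [ENNReal.le_ofReal_iff_toReal_le hC (by positivity)]
    linarith
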